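/- There exist constants K > 0 and δ > 0, independent of N, m, A and B, such that whenever A ≥ 1, B ≥ 1 and K|ε| < 1, the map F has exactly one fixed point (E, e) in the closed ball ‖(E, e)‖_w ≤ δ for the weighted norm ‖(E, e)‖_w := |E|·(K|ε|)^{−2} + Σ_{X:m, X ≠ ∅} (λ(X)−2)·|e(X)|·(K|ε|)^{−w(X)}. In particular this fixed point satisfies |E| ≤ δ·(K|ε|)² and (λ(X)−2)·|e(X)| ≤ δ·(K|ε|)^{w(X)} for every nonempty X with X:m. -/

import Mathlib

open Finset
open scoped symmDiff

/-- The set of bonds `⟨j,j+1⟩` (labelled by `j ∈ {1,…,N-1}`) such that exactly one of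
`j`, `j+1` belongs to `Y`. -/
def bdry (N : ℕ) (Y : Finset ℕ) : Finset ℕ :=
  (Finset.Icc 1 (N - 1)).filter fun j => (j ∈ Y ∧ j + 1 ∉ Y) ∨ (j ∉ Y ∧ j + 1 ∈ Y)

/-- `λ(X) = 2·|∂(X Δ M)| + 2A·[1 ∈ X] + 2B·[N ∈ X]`, where `M = {1,…,m}`. -/
def lam (N m : ℕ) (A B : ℝ) (X : Finset ℕ) : ℝ :=
  2 * (bdry N (X ∆ Finset.Icc 1 m)).card
    + 2 * A * (if 1 ∈ X then 1 else 0)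
    + 2 * B * (if N ∈ X then 1 else 0)

/-- The sets `X ⊆ {1,…,N}` satisfying `X:m`, i.e. `|X Δ M| = m` where `M = {1,…,m}`. -/
def sector (N m : ℕ) : Finset (Finset ℕ) :=
  (Finset.Icc 1 N).powerset.filter fun X => (X ∆ Finset.Icc 1 m).card = m

/-- Extend a family of coefficients by setting `e(∅) := 1`. -/
def kext (e : Finset ℕ → ℝ) : Finset ℕ → ℝ := fun X => if X = ∅ then 1 else e X

/-- The kink fixed-point map `F(E, e) = (E′, e′)`, where `E′ = 2ε·e({m,m+1})` and, for
nonempty `X` with `X:m`,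
`e′(X) = (λ(X)−2)⁻¹·[−2ε·Σ_{⟨j,j+1⟩ ∈ ∂(X Δ M)} e(X Δ {j,j+1}) + E·e(X)]`
(with the convention `e(∅) = 1`); all other components are set to `0`. -/
noncomputable def kinkF (N m : ℕ) (ε A B : ℝ) (p : ℝ × (Finset ℕ → ℝ)) : ℝ × (Finset ℕ → ℝ) :=
  (2 * ε * p.2 {m, m + 1},
    fun X =>
      if X ∈ sector N m ∧ X ≠ ∅ then
        (lam N m A B X - 2)⁻¹ *
          (-2 * ε * ∑ j ∈ bdry N (X ∆ Finset.Icc 1 m), kext p.2 (X ∆ {j, j + 1})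
            + p.1 * p.2 X)
      else 0)

/-- The norm `‖(E, e)‖ = |E| + Σ_{X:m, X ≠ ∅} (λ(X)−2)·|e(X)|`. -/
def knorm (N m : ℕ) (A B : ℝ) (p : ℝ × (Finset ℕ → ℝ)) : ℝ :=
  |p.1| + ∑ X ∈ (sector N m).filter (· ≠ ∅), (lam N m A B X - 2) * |p.2 X|

/-- `kreach N m n X` holds iff there is an admissible sequence
`X_0 = ∅, X_1, …, X_n = X` of subsets of `{1,…,N}`, each satisfying `X_i:m`, with
`X_i = X_{i−1} Δ {j, j+1}` for some bond `⟨j,j+1⟩ ∈ ∂(X_{i−1} Δ M)`. -/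
def kreach (N m : ℕ) (n : ℕ) (X : Finset ℕ) : Prop :=
  ∃ f : ℕ → Finset ℕ, f 0 = ∅ ∧ f n = X ∧
    (∀ i ≤ n, f i ⊆ Finset.Icc 1 N ∧ (f i ∆ Finset.Icc 1 m).card = m) ∧
    (∀ i < n, ∃ j ∈ bdry N (f i ∆ Finset.Icc 1 m), f (i + 1) = f i ∆ {j, j + 1})

/-- The weight `w(X)`: the minimal length of an admissible flip sequence from `∅`
to `X` (`+∞` if there is none). -/
noncomputable def kw (N m : ℕ) (X : Finset ℕ) : ℕ∞ :=
  sInf {c : ℕ∞ | ∃ k : ℕ, c = (k : ℕ∞) ∧ kreach N m k X}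

open scoped ENNReal

/-- `x` raised to an extended-natural-number power `n`; for `n = ⊤` the value is `0`
(the correct value `x^∞` for bases `x < 1`, the only case in which it is used). -/
noncomputable def epow (x : ℝ≥0∞) (n : ℕ∞) : ℝ≥0∞ := if n = ⊤ then 0 else x ^ n.toNat

/-- The weighted norm
`‖(E, e)‖_w = |E|·(K|ε|)^{−2} + Σ_{X:m, X ≠ ∅} (λ(X)−2)·|e(X)|·(K|ε|)^{−w(X)}`,
valued in `ℝ≥0∞`. -/
noncomputable def kwnorm (N m : ℕ) (A B K ε : ℝ) (p : ℝ × (Finset ℕ → ℝ)) : ℝ≥0∞ :=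
  ENNReal.ofReal |p.1| / ENNReal.ofReal (K * |ε|) ^ 2
    + ∑ X ∈ (sector N m).filter (· ≠ ∅),
        ENNReal.ofReal ((lam N m A B X - 2) * |p.2 X|)
          / epow (ENNReal.ofReal (K * |ε|)) (kw N m X)

lemma mem_sector {N m : ℕ} {X : Finset ℕ} :
    X ∈ sector N m ↔ X ⊆ Icc 1 N ∧ (X ∆ Icc 1 m).card = m := by
  simp [sector]

lemma mem_bdry {N : ℕ} {Y : Finset ℕ} {j : ℕ} :
    j ∈ bdry N Y ↔ (1 ≤ j ∧ j + 1 ≤ N) ∧ ((j ∈ Y ∧ j + 1 ∉ Y) ∨ (j ∉ Y ∧ j + 1 ∈ Y)) := by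
  simp only [bdry, mem_filter, mem_Icc]
  refine and_congr_left fun _ => ?_
  omega

lemma symmDiff_pair_comm (X M : Finset ℕ) (j : ℕ) :
    (X ∆ {j, j + 1}) ∆ M = (X ∆ M) ∆ {j, j + 1} := by
  rw [symmDiff_assoc, symmDiff_comm {j, j + 1}, ← symmDiff_assoc]

lemma mem_bdry_flip {N : ℕ} {Y : Finset ℕ} {j : ℕ} (hj : j ∈ bdry N Y) :
    j ∈ bdry N (Y ∆ {j, j + 1}) := by
  rw [mem_bdry] at hj ⊢
  refine ⟨hj.1, ?_⟩
  have := hj.2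
  simp only [mem_symmDiff, mem_insert, mem_singleton]
  simp
  tauto

lemma flip_of_rise {Y : Finset ℕ} {j : ℕ} (h : j ∉ Y) (h' : j + 1 ∈ Y) :
    Y ∆ {j, j + 1} = insert j (Y.erase (j + 1)) := by
  ext i
  simp only [mem_symmDiff, mem_insert, mem_singleton, mem_erase]
  grind

lemma flip_of_fall {Y : Finset ℕ} {j : ℕ} (h : j ∈ Y) (h' : j + 1 ∉ Y) :
    Y ∆ {j, j + 1} = insert (j + 1) (Y.erase j) := by
  ext i
  simp only [mem_symmDiff, mem_insert, mem_singleton, mem_erase]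
  grind

lemma card_flip {N : ℕ} {Y : Finset ℕ} {j : ℕ} (hj : j ∈ bdry N Y) :
    (Y ∆ {j, j + 1}).card = Y.card := by
  rw [mem_bdry] at hj
  obtain ⟨h, h'⟩ | ⟨h, h'⟩ := hj.2
  · rw [flip_of_fall h h', card_insert_of_notMem (by simp [h']), card_erase_add_one h]
  · rw [flip_of_rise h h', card_insert_of_notMem (by simp [h]), card_erase_add_one h']

lemma flip_mem_sector {N m : ℕ} {X : Finset ℕ} {j : ℕ} (hX : X ∈ sector N m)
    (hj : j ∈ bdry N (X ∆ Icc 1 m)) : X ∆ {j, j + 1} ∈ sector N m := by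
  rw [mem_sector] at hX ⊢
  refine ⟨?_, ?_⟩
  · rw [mem_bdry] at hj
    intro i hi
    simp only [mem_symmDiff, mem_insert, mem_singleton] at hi
    rcases hi with hi | hi
    · exact hX.1 hi.1
    · rw [mem_Icc]
      omega
  · rw [symmDiff_pair_comm, card_flip hj, hX.2]

lemma mem_bdry_flip_symmDiff {N m : ℕ} {X : Finset ℕ} {j : ℕ} (hj : j ∈ bdry N (X ∆ Icc 1 m)) :
    j ∈ bdry N ((X ∆ {j, j + 1}) ∆ Icc 1 m) := by
  rw [symmDiff_pair_comm]
  exact mem_bdry_flip hj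

lemma exists_switch {P : ℕ → Prop} {a b : ℕ} (hab : a ≤ b) (ha : P a) (hb : ¬ P b) :
    ∃ i, a ≤ i ∧ i < b ∧ P i ∧ ¬ P (i + 1) := by
  induction b, hab using Nat.le_induction with
  | base => exact absurd ha hb
  | succ n hn ih =>
    by_cases h : P n
    · exact ⟨n, hn, n.lt_succ_self, h, hb⟩
    · obtain ⟨i, h1, h2, h3⟩ := ih h
      exact ⟨i, h1, h2.trans n.lt_succ_self, h3⟩

lemma exists_rise {N m : ℕ} {Y : Finset ℕ} (hY : Y ⊆ Icc 1 N) (hc : Y.card = m)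
    (hne : Y ≠ Icc 1 m) : ∃ j, 1 ≤ j ∧ j + 1 ≤ N ∧ j ∉ Y ∧ j + 1 ∈ Y := by
  have h1 : ∃ a ∈ Icc 1 m, a ∉ Y := by
    by_contra! h
    exact hne (eq_of_subset_of_card_le h (by simp [hc])).symm
  have h2 : ∃ b ∈ Y, b ∉ Icc 1 m := by
    by_contra! h
    exact hne (eq_of_subset_of_card_le h (by simp [hc]))
  obtain ⟨a, ha, haY⟩ := h1
  obtain ⟨b, hb, hbM⟩ := h2
  have hbN := hY hb
  rw [mem_Icc] at ha hbM hbN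
  obtain ⟨i, h1, h2, h3, h4⟩ :=
    exists_switch (P := (· ∉ Y)) (a := a) (b := b) (by omega) haY (not_not.2 hb)
  exact ⟨i, by omega, by omega, h3, not_not.1 h4⟩

lemma symmDiff_Icc_subset {N m : ℕ} (hm : m < N) {X : Finset ℕ} (hX : X ∈ sector N m) :
    X ∆ Icc 1 m ⊆ Icc 1 N := by
  intro i hi
  rw [mem_symmDiff] at hi
  rcases hi with hi | hi
  · exact (mem_sector.1 hX).1 hi.1
  · have := hi.1
    rw [mem_Icc] at this ⊢
    omega

lemma symmDiff_Icc_ne {m : ℕ} {X : Finset ℕ} (hX : X ≠ ∅) : X ∆ Icc 1 m ≠ Icc 1 m := by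
  rwa [Ne, symmDiff_eq_right, bot_eq_empty]

lemma lam_bounds {N m : ℕ} {A B : ℝ} (hm : 0 < m) (hmN : m < N) (hA : 1 ≤ A) (hB : 1 ≤ B)
    {X : Finset ℕ} (hX : X ∈ sector N m) (hne : X ≠ ∅) :
    ((bdry N (X ∆ Icc 1 m)).card : ℝ) ≤ lam N m A B X - 2 ∧ 2 ≤ lam N m A B X - 2 := by
  obtain ⟨j, hj1, hjN, hj, hj'⟩ := exists_rise (symmDiff_Icc_subset hmN hX)
    (mem_sector.1 hX).2 (symmDiff_Icc_ne hne)
  set Y := X ∆ Icc 1 m with hY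
  have hjb : j ∈ bdry N Y := mem_bdry.2 ⟨⟨hj1, hjN⟩, Or.inr ⟨hj, hj'⟩⟩
  have hpos : 0 < (bdry N Y).card := card_pos.2 ⟨j, hjb⟩
  rcases Nat.lt_or_ge 1 (bdry N Y).card with h2 | h2
  · have h2' : (2 : ℝ) ≤ (bdry N Y).card := by exact_mod_cast h2
    have h3 : lam N m A B X ≥ 2 * (bdry N Y).card := by
      unfold lam
      split_ifs <;> linarith
    constructor <;> linarith
  · have hone : (bdry N Y).card = 1 := by omega
    have huniq : ∀ i ∈ bdry N Y, i = j := fun i hi => card_le_one.1 h2 i hi j hjb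
    have h1Y : 1 ∉ Y := by
      intro h
      obtain ⟨i, hi1, hij, hi, hi'⟩ := exists_switch (P := (· ∈ Y)) hj1 h hj
      have := huniq i (mem_bdry.2 ⟨⟨hi1, by omega⟩, Or.inl ⟨hi, hi'⟩⟩)
      omega
    have hNY : N ∈ Y := by
      by_contra h
      obtain ⟨i, hi1, hij, hi, hi'⟩ := exists_switch (P := (· ∈ Y)) hjN hj' h
      have := huniq i (mem_bdry.2 ⟨⟨by omega, by omega⟩, Or.inl ⟨hi, hi'⟩⟩)
      omega
    have h1X : 1 ∈ X := by
      by_contra h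
      exact h1Y (mem_symmDiff.2 (Or.inr ⟨mem_Icc.2 ⟨le_rfl, hm⟩, h⟩))
    have hNX : N ∈ X := by
      rcases mem_symmDiff.1 hNY with h | h
      · exact h.1
      · have := mem_Icc.1 h.1
        omega
    have : lam N m A B X = 2 + 2 * A + 2 * B := by
      unfold lam
      rw [← hY, hone, if_pos h1X, if_pos hNX]
      push_cast
      ring
    rw [this, hone]
    push_cast
    constructor <;> linarith

lemma empty_mem_sector (N m : ℕ) : ∅ ∈ sector N m := by
  rw [mem_sector, ← bot_eq_empty, bot_symmDiff]
  simp

lemma bdry_Icc {N m : ℕ} (hm : 0 < m) (hmN : m < N) : bdry N (∅ ∆ Icc 1 m) = {m} := by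
  ext j
  rw [mem_bdry, ← bot_eq_empty, bot_symmDiff, mem_Icc, mem_Icc, mem_singleton]
  omega

lemma pair_mem_sector {N m : ℕ} (hm : 0 < m) (hmN : m < N) : {m, m + 1} ∈ sector N m := by
  have h := flip_mem_sector (empty_mem_sector N m) (j := m) (by simp [bdry_Icc hm hmN])
  rwa [← bot_eq_empty, bot_symmDiff] at h

lemma kreach_zero (N m : ℕ) : kreach N m 0 ∅ := by
  refine ⟨fun _ => ∅, rfl, rfl, fun i _ => mem_sector.1 (empty_mem_sector N m), ?_⟩
  simp

lemma kreach.mem_sector {N m n : ℕ} {X : Finset ℕ} (h : kreach N m n X) : X ∈ sector N m := by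
  obtain ⟨f, -, rfl, hs, -⟩ := h
  exact _root_.mem_sector.2 (hs n le_rfl)

lemma kreach.flip {N m n : ℕ} {X : Finset ℕ} {j : ℕ} (h : kreach N m n X)
    (hj : j ∈ bdry N (X ∆ Icc 1 m)) : kreach N m (n + 1) (X ∆ {j, j + 1}) := by
  have hX := flip_mem_sector h.mem_sector hj
  obtain ⟨f, h0, rfl, hs, hf⟩ := h
  refine ⟨fun i => if i ≤ n then f i else f n ∆ {j, j + 1}, by simpa using h0, by simp, ?_, ?_⟩
  · intro i _
    by_cases hi : i ≤ n
    · simpa [hi] using hs i hi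
    · simpa [hi] using _root_.mem_sector.1 hX
  · intro i hi
    rcases Nat.lt_succ_iff_lt_or_eq.1 hi with hi | rfl
    · simpa [hi.le, Nat.succ_le_of_lt hi] using hf i hi
    · exact ⟨j, by simpa using hj, by simp⟩

lemma exists_kreach {N m : ℕ} (hmN : m < N) {X : Finset ℕ} (hX : X ∈ sector N m) :
    ∃ n, kreach N m n X := by
  induction h : ∑ i ∈ X ∆ Icc 1 m, i using Nat.strong_induction_on generalizing X with
  | _ s ih =>
    by_cases hne : X = ∅
    · exact ⟨0, hne ▸ kreach_zero N m⟩
    obtain ⟨j, hj1, hjN, hj, hj'⟩ := exists_rise (symmDiff_Icc_subset hmN hX)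
      (mem_sector.1 hX).2 (symmDiff_Icc_ne hne)
    have hjb : j ∈ bdry N (X ∆ Icc 1 m) := mem_bdry.2 ⟨⟨hj1, hjN⟩, Or.inr ⟨hj, hj'⟩⟩
    obtain ⟨n, hn⟩ := ih (∑ i ∈ (X ∆ {j, j + 1}) ∆ Icc 1 m, i) (by
      rw [symmDiff_pair_comm, flip_of_rise hj hj', sum_insert (by simp [hj]), ← h,
        ← add_sum_erase _ _ hj']
      omega) (flip_mem_sector hX hjb) rfl
    have := hn.flip (mem_bdry_flip_symmDiff hjb)
    rw [symmDiff_symmDiff_cancel_right] at this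
    exact ⟨n + 1, this⟩

lemma kw_le_of_kreach {N m n : ℕ} {X : Finset ℕ} (h : kreach N m n X) : kw N m X ≤ n :=
  sInf_le ⟨n, rfl, h⟩

lemma kw_ne_top {N m : ℕ} (hmN : m < N) {X : Finset ℕ} (hX : X ∈ sector N m) :
    kw N m X ≠ ⊤ := by
  obtain ⟨n, hn⟩ := exists_kreach hmN hX
  exact ne_top_of_le_ne_top (ENat.natCast_ne_top n) (kw_le_of_kreach hn)

lemma kreach_toNat_kw {N m : ℕ} (hmN : m < N) {X : Finset ℕ} (hX : X ∈ sector N m) :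
    kreach N m (kw N m X).toNat X := by
  obtain ⟨n, hn⟩ := exists_kreach hmN hX
  obtain ⟨k, hk, hk'⟩ := csInf_mem (s := {c : ℕ∞ | ∃ k : ℕ, c = (k : ℕ∞) ∧ kreach N m k X})
    ⟨n, n, rfl, hn⟩
  rw [kw, hk]
  exact hk'

lemma toNat_kw_le_of_kreach {N m n : ℕ} {X : Finset ℕ} (h : kreach N m n X) :
    (kw N m X).toNat ≤ n :=
  ENat.toNat_le_of_le_natCast (kw_le_of_kreach h)

lemma toNat_kw_flip_le {N m : ℕ} (hmN : m < N) {X : Finset ℕ} {j : ℕ} (hX : X ∈ sector N m)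
    (hj : j ∈ bdry N (X ∆ Icc 1 m)) :
    (kw N m X).toNat ≤ (kw N m (X ∆ {j, j + 1})).toNat + 1 := by
  have h := (kreach_toNat_kw hmN (flip_mem_sector hX hj)).flip (mem_bdry_flip_symmDiff hj)
  rw [symmDiff_symmDiff_cancel_right] at h
  exact toNat_kw_le_of_kreach h

lemma toNat_kw_empty (N m : ℕ) : (kw N m ∅).toNat = 0 :=
  Nat.le_zero.1 (toNat_kw_le_of_kreach (kreach_zero N m))

lemma one_le_toNat_kw {N m : ℕ} (hmN : m < N) {X : Finset ℕ} (hX : X ∈ sector N m)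
    (hne : X ≠ ∅) : 1 ≤ (kw N m X).toNat := by
  by_contra! h
  obtain ⟨f, h0, h1, -⟩ := kreach_toNat_kw hmN hX
  rw [Nat.lt_one_iff.1 h, h0] at h1
  exact hne h1.symm

/-- Weighted `ℓ¹` norm on `ℝ × (α → ℝ)`, with the second component restricted to `S`. -/
def weightedL1 {α : Type*} (S : Finset α) (a : ℝ) (g : α → ℝ) (p : ℝ × (α → ℝ)) : ℝ :=
  a * |p.1| + ∑ X ∈ S, g X * |p.2 X|

lemma weightedL1_add_le {α : Type*} {S : Finset α} {a : ℝ} {g : α → ℝ} (ha : 0 ≤ a)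
    (hg : ∀ X ∈ S, 0 ≤ g X) (p q : ℝ × (α → ℝ)) :
    weightedL1 S a g (p + q) ≤ weightedL1 S a g p + weightedL1 S a g q := by
  unfold weightedL1
  have h1 : a * |(p + q).1| ≤ a * |p.1| + a * |q.1| := by
    rw [← mul_add]
    exact mul_le_mul_of_nonneg_left (abs_add_le _ _) ha
  have h2 : ∑ X ∈ S, g X * |(p + q).2 X| ≤ ∑ X ∈ S, g X * |p.2 X| + ∑ X ∈ S, g X * |q.2 X| := by
    rw [← sum_add_distrib]
    refine sum_le_sum fun X hX => ?_
    rw [← mul_add]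
    exact mul_le_mul_of_nonneg_left (abs_add_le _ _) (hg X hX)
  linarith

/-- Banach's fixed point theorem on a closed ball of a weighted `ℓ¹` norm. -/
lemma existsUnique_fixedPoint_weightedL1 {α : Type*} {S : Finset α} {a : ℝ} {g : α → ℝ}
    (ha : 0 < a) (hg : ∀ X ∈ S, 0 < g X) (T : ℝ × (α → ℝ) → ℝ × (α → ℝ))
    (hsupp : ∀ p, ∀ X ∉ S, (T p).2 X = 0) {δ k : ℝ} (hδ : 0 ≤ δ) (hk0 : 0 ≤ k) (hk : k < 1)
    (hmaps : ∀ p, weightedL1 S a g p ≤ δ → weightedL1 S a g (T p) ≤ δ)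
    (hcontr : ∀ p q, weightedL1 S a g p ≤ δ → weightedL1 S a g q ≤ δ →
      weightedL1 S a g (T p - T q) ≤ k * weightedL1 S a g (p - q)) :
    ∃! p, weightedL1 S a g p ≤ δ ∧ T p = p := by
  classical
  let V := PiLp 1 (fun _ : Option S => ℝ)
  let ψ : ℝ × (α → ℝ) → V := fun p =>
    WithLp.toLp 1 fun o => o.elim (a * p.1) fun X => g X * p.2 X
  let φ : V → ℝ × (α → ℝ) := fun v =>
    (v none / a, fun X => if h : X ∈ S then v (some ⟨X, h⟩) / g X else 0)
  have hψφ : ∀ v, ψ (φ v) = v := by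
    intro v
    ext o
    rcases o with _ | ⟨X, hX⟩
    · simp only [ψ, φ, Option.elim]
      field_simp
    · have := (hg X hX).ne'
      simp only [ψ, φ, Option.elim, hX, dif_pos]
      field_simp
  have hφψ : ∀ p : ℝ × (α → ℝ), (∀ X ∉ S, p.2 X = 0) → φ (ψ p) = p := by
    intro p hp
    refine Prod.ext ?_ (funext fun X => ?_)
    · simp only [ψ, φ, Option.elim]
      field_simp
    · by_cases hX : X ∈ S
      · have := (hg X hX).ne'
        simp only [ψ, φ, Option.elim, hX, dif_pos]
        field_simp
      · simp only [φ, hX, dif_neg, not_false_eq_true, hp X hX]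
  have hnorm : ∀ p, ‖ψ p‖ = weightedL1 S a g p := by
    intro p
    rw [PiLp.norm_eq_of_L1, Fintype.sum_option, weightedL1, ← sum_coe_sort S]
    simp only [ψ, Option.elim, Real.norm_eq_abs, abs_mul, abs_of_pos ha]
    congr 1
    exact sum_congr rfl fun X _ => by rw [abs_of_pos (hg X X.2)]
  have hsub : ∀ p q, ψ p - ψ q = ψ (p - q) := by
    intro p q
    ext o
    rcases o with _ | X
    · exact (mul_sub _ _ _).symm
    · exact (mul_sub _ _ _).symm
  have hball : ∀ v, v ∈ Metric.closedBall (0 : V) δ ↔ weightedL1 S a g (φ v) ≤ δ := by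
    intro v
    rw [mem_closedBall_zero_iff, ← hnorm, hψφ]
  have hmapsTo : Set.MapsTo (fun v => ψ (T (φ v))) (Metric.closedBall (0 : V) δ)
      (Metric.closedBall (0 : V) δ) := by
    intro v hv
    rw [mem_closedBall_zero_iff, hnorm]
    exact hmaps _ ((hball v).1 hv)
  have hcw : ContractingWith ⟨k, hk0⟩ (hmapsTo.restrict _ _ _) := by
    refine ⟨by exact_mod_cast hk, LipschitzWith.of_dist_le_mul fun u v => ?_⟩
    rw [Subtype.dist_eq, Subtype.dist_eq, dist_eq_norm, dist_eq_norm]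
    simp only [Set.MapsTo.val_restrict_apply]
    rw [hsub, hnorm]
    refine (hcontr _ _ ((hball _).1 u.2) ((hball _).1 v.2)).trans_eq ?_
    rw [← hnorm, ← hsub, hψφ, hψφ]
    rfl
  obtain ⟨v, hv, hfix, -⟩ := hcw.exists_fixedPoint' Metric.isClosed_closedBall.isComplete hmapsTo
    (Metric.mem_closedBall_self hδ) (edist_ne_top _ _)
  have hfix' : T (φ v) = φ v := by
    have h : ψ (T (φ v)) = v := hfix
    rw [← hφψ (T (φ v)) (hsupp _), h]
  refine ⟨φ v, ⟨(hball v).1 hv, hfix'⟩, ?_⟩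
  rintro q ⟨hq, hTq⟩
  have h := hcontr q (φ v) hq ((hball v).1 hv)
  rw [hTq, hfix', ← hnorm, ← hsub] at h
  have h0 : ‖ψ q - ψ (φ v)‖ = 0 := by
    nlinarith [norm_nonneg (ψ q - ψ (φ v))]
  rw [norm_eq_zero, sub_eq_zero] at h0
  rw [← hφψ q fun X hX => by rw [← hTq]; exact hsupp q X hX, h0, hψφ]

lemma sum_flip_sector (N m : ℕ) (G : Finset ℕ → Finset ℕ → ℝ) :
    ∑ X ∈ sector N m, ∑ j ∈ bdry N (X ∆ Icc 1 m), G X (X ∆ {j, j + 1}) =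
      ∑ Y ∈ sector N m, ∑ j ∈ bdry N (Y ∆ Icc 1 m), G (Y ∆ {j, j + 1}) Y := by
  rw [sum_sigma', sum_sigma']
  refine sum_nbij' (fun s => ⟨s.1 ∆ {s.2, s.2 + 1}, s.2⟩) (fun s => ⟨s.1 ∆ {s.2, s.2 + 1}, s.2⟩)
    ?_ ?_ ?_ ?_ ?_
  · intro s hs
    rw [mem_sigma] at hs ⊢
    exact ⟨flip_mem_sector hs.1 hs.2, mem_bdry_flip_symmDiff hs.2⟩
  · intro s hs
    rw [mem_sigma] at hs ⊢
    exact ⟨flip_mem_sector hs.1 hs.2, mem_bdry_flip_symmDiff hs.2⟩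
  · intro s _
    simp [symmDiff_symmDiff_cancel_right]
  · intro s _
    simp [symmDiff_symmDiff_cancel_right]
  · intro s _
    simp [symmDiff_symmDiff_cancel_right]

lemma sum_hopping_le {N m : ℕ} (hmN : m < N) {x : ℝ} (hx0 : 0 < x) (hx1 : x ≤ 1)
    {h : Finset ℕ → ℝ} (hh : ∀ X, 0 ≤ h X) :
    ∑ X ∈ sector N m, (x ^ (kw N m X).toNat)⁻¹ *
        ∑ j ∈ bdry N (X ∆ Icc 1 m), h (X ∆ {j, j + 1}) ≤
      x⁻¹ * ∑ Y ∈ sector N m,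
        ((bdry N (Y ∆ Icc 1 m)).card : ℝ) * ((x ^ (kw N m Y).toNat)⁻¹ * h Y) := by
  simp_rw [mul_sum]
  rw [sum_flip_sector N m fun X Y => (x ^ (kw N m X).toNat)⁻¹ * h Y]
  refine sum_le_sum fun Y hY => ?_
  have key : ∀ j ∈ bdry N (Y ∆ Icc 1 m), (x ^ (kw N m (Y ∆ {j, j + 1})).toNat)⁻¹ * h Y ≤
      x⁻¹ * ((x ^ (kw N m Y).toNat)⁻¹ * h Y) := by
    intro j hj
    have hw := toNat_kw_flip_le hmN (flip_mem_sector hY hj) (mem_bdry_flip_symmDiff hj)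
    rw [symmDiff_symmDiff_cancel_right] at hw
    rw [← mul_assoc, ← mul_inv, ← pow_succ']
    refine mul_le_mul_of_nonneg_right ?_ (hh Y)
    exact inv_anti₀ (pow_pos hx0 _) (pow_le_pow_of_le_one hx0.le hx1 hw)
  refine (sum_le_card_nsmul _ _ _ key).trans_eq ?_
  rw [nsmul_eq_mul]
  ring

lemma sector_eq_insert (N m : ℕ) : sector N m = insert ∅ ((sector N m).filter (· ≠ ∅)) := by
  ext X
  by_cases h : X = ∅
  · simp [h, empty_mem_sector]
  · simp [h]

lemma sum_hopping_filter_le {N m : ℕ} {A B : ℝ} (hm : 0 < m) (hmN : m < N) (hA : 1 ≤ A)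
    (hB : 1 ≤ B) {x : ℝ} (hx0 : 0 < x) (hx1 : x ≤ 1) {h : Finset ℕ → ℝ} (hh : ∀ X, 0 ≤ h X) :
    ∑ X ∈ (sector N m).filter (· ≠ ∅), (x ^ (kw N m X).toNat)⁻¹ *
        ∑ j ∈ bdry N (X ∆ Icc 1 m), h (X ∆ {j, j + 1}) ≤
      x⁻¹ * (h ∅ + ∑ X ∈ (sector N m).filter (· ≠ ∅),
        (lam N m A B X - 2) * (x ^ (kw N m X).toNat)⁻¹ * h X) := by
  have hp : ∀ X, 0 ≤ (x ^ (kw N m X).toNat)⁻¹ := fun X => inv_nonneg.2 (pow_nonneg hx0.le _)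
  refine (sum_le_sum_of_subset_of_nonneg (filter_subset _ _) fun X _ _ =>
    mul_nonneg (hp X) (sum_nonneg fun j _ => hh _)).trans
    ((sum_hopping_le hmN hx0 hx1 hh).trans ?_)
  refine mul_le_mul_of_nonneg_left ?_ (inv_nonneg.2 hx0.le)
  conv_lhs => rw [sector_eq_insert]
  rw [sum_insert (by simp)]
  refine add_le_add ?_ (sum_le_sum fun X hX => ?_)
  · simp [bdry_Icc hm hmN, toNat_kw_empty]
  · rw [mem_filter] at hX
    rw [mul_assoc]
    exact mul_le_mul_of_nonneg_right (lam_bounds hm hmN hA hB hX.1 hX.2).1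
      (mul_nonneg (hp X) (hh X))

/-- The weight of the component `e(X)` in the weighted norm. -/
noncomputable def kweight (N m : ℕ) (A B x : ℝ) (X : Finset ℕ) : ℝ :=
  (lam N m A B X - 2) * (x ^ (kw N m X).toNat)⁻¹

lemma kweight_pos {N m : ℕ} {A B x : ℝ} (hm : 0 < m) (hmN : m < N) (hA : 1 ≤ A)
    (hB : 1 ≤ B) (hx0 : 0 < x) {X : Finset ℕ} (hX : X ∈ (sector N m).filter (· ≠ ∅)) :
    0 < kweight N m A B x X := by
  rw [mem_filter] at hX
  have := (lam_bounds hm hmN hA hB hX.1 hX.2).2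
  exact mul_pos (by linarith) (inv_pos.2 (pow_pos hx0 _))

/-- The weighted norm as a real number, for `x = K|ε|` positive. -/
noncomputable def kwnormReal (N m : ℕ) (A B x : ℝ) (p : ℝ × (Finset ℕ → ℝ)) : ℝ :=
  weightedL1 ((sector N m).filter (· ≠ ∅)) (x ^ 2)⁻¹ (kweight N m A B x) p

lemma kwnorm_eq_ofReal {N m : ℕ} {A B K ε : ℝ} (hm : 0 < m) (hmN : m < N) (hA : 1 ≤ A)
    (hB : 1 ≤ B) (hx0 : 0 < K * |ε|) (p : ℝ × (Finset ℕ → ℝ)) :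
    kwnorm N m A B K ε p = ENNReal.ofReal (kwnormReal N m A B (K * |ε|) p) := by
  have hnn : ∀ X ∈ (sector N m).filter (· ≠ ∅), 0 ≤ kweight N m A B (K * |ε|) X * |p.2 X| :=
    fun X hX => mul_nonneg (kweight_pos hm hmN hA hB hx0 hX).le (abs_nonneg _)
  rw [kwnorm, kwnormReal, weightedL1,
    ENNReal.ofReal_add (mul_nonneg (by positivity) (abs_nonneg _)) (sum_nonneg hnn),
    ENNReal.ofReal_sum_of_nonneg hnn]
  congr 1
  · rw [← ENNReal.ofReal_pow hx0.le, ← ENNReal.ofReal_div_of_pos (by positivity), div_eq_inv_mul]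
  · refine sum_congr rfl fun X hX => ?_
    rw [epow, if_neg (kw_ne_top hmN (mem_filter.1 hX).1), ← ENNReal.ofReal_pow hx0.le,
      ← ENNReal.ofReal_div_of_pos (by positivity), kweight]
    congr 1
    ring

lemma kweight_mul_kinkF_snd {N m : ℕ} {A B x : ℝ} (ε : ℝ) (hm : 0 < m) (hmN : m < N)
    (hA : 1 ≤ A) (hB : 1 ≤ B) {X : Finset ℕ} (hX : X ∈ (sector N m).filter (· ≠ ∅))
    (p : ℝ × (Finset ℕ → ℝ)) :
    kweight N m A B x X * (kinkF N m ε A B p).2 X = (x ^ (kw N m X).toNat)⁻¹ *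
      (-2 * ε * ∑ j ∈ bdry N (X ∆ Icc 1 m), kext p.2 (X ∆ {j, j + 1}) + p.1 * p.2 X) := by
  rw [mem_filter] at hX
  have h := (lam_bounds hm hmN hA hB hX.1 hX.2).2
  have h' : lam N m A B X - 2 ≠ 0 := by linarith
  simp only [kinkF, kweight, if_pos hX]
  field_simp

lemma kwnormReal_kinkF_zero_le {N m : ℕ} {A B K ε : ℝ} (hm : 0 < m) (hmN : m < N)
    (hA : 1 ≤ A) (hB : 1 ≤ B) (hx0 : 0 < K * |ε|) (hx1 : K * |ε| ≤ 1) :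
    kwnormReal N m A B (K * |ε|) (kinkF N m ε A B 0) ≤ 2 / K := by
  set x := K * |ε| with hx
  have h1 : ∀ X ∈ (sector N m).filter (· ≠ ∅),
      kweight N m A B x X * |(kinkF N m ε A B 0).2 X| = 2 * |ε| * ((x ^ (kw N m X).toNat)⁻¹ *
        ∑ j ∈ bdry N (X ∆ Icc 1 m), kext 0 (X ∆ {j, j + 1})) := by
    intro X hX
    have hs : 0 ≤ ∑ j ∈ bdry N (X ∆ Icc 1 m), kext 0 (X ∆ {j, j + 1}) :=
      sum_nonneg fun j _ => by unfold kext; split_ifs <;> simp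
    rw [← abs_of_pos (kweight_pos hm hmN hA hB hx0 hX), ← abs_mul,
      kweight_mul_kinkF_snd ε hm hmN hA hB hX, abs_mul,
      abs_of_pos (inv_pos.2 (pow_pos hx0 _))]
    simp only [Prod.fst_zero, Prod.snd_zero, zero_mul, add_zero, abs_mul, abs_neg, abs_of_nonneg hs]
    rw [abs_two]
    ring
  have h2 := sum_hopping_filter_le (A := A) (B := B) hm hmN hA hB hx0 hx1 (h := kext 0)
    fun X => by unfold kext; split_ifs <;> simp
  have h3 : ∑ X ∈ (sector N m).filter (· ≠ ∅),
      (lam N m A B X - 2) * (x ^ (kw N m X).toNat)⁻¹ * kext 0 X = 0 :=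
    sum_eq_zero fun X hX => by simp [kext, (mem_filter.1 hX).2]
  have h4 : kext 0 ∅ = 1 := by simp [kext]
  rw [h3, h4] at h2
  have hE : (kinkF N m ε A B 0).1 = 0 := by simp [kinkF]
  rw [kwnormReal, weightedL1, hE, sum_congr rfl h1, ← mul_sum]
  have hε : 0 < |ε| := (abs_nonneg ε).lt_of_ne fun h => by simp [hx, ← h] at hx0
  have hK : 0 < K := pos_of_mul_pos_left hx0 hε.le
  calc _ ≤ 2 * |ε| * (x⁻¹ * (1 + 0)) := by
        simpa using mul_le_mul_of_nonneg_left h2 (by positivity : 0 ≤ 2 * |ε|)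
    _ = 2 / K := by
        rw [hx]
        field_simp
        ring

lemma kinkF_sub_fst_le {N m : ℕ} {A B K ε : ℝ} (hm : 0 < m) (hmN : m < N)
    (hA : 1 ≤ A) (hB : 1 ≤ B) (hx0 : 0 < K * |ε|) (hx1 : K * |ε| ≤ 1)
    (p q : ℝ × (Finset ℕ → ℝ)) :
    ((K * |ε|) ^ 2)⁻¹ * |(kinkF N m ε A B p - kinkF N m ε A B q).1| ≤
      1 / K * ∑ X ∈ (sector N m).filter (· ≠ ∅),
        kweight N m A B (K * |ε|) X * |p.2 X - q.2 X| := by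
  have hε : 0 < |ε| := (abs_nonneg ε).lt_of_ne fun h => by simp [← h] at hx0
  have hK : 0 < K := pos_of_mul_pos_left hx0 hε.le
  set x := K * |ε| with hx
  set S := (sector N m).filter (· ≠ ∅)
  have hgpos : ∀ X ∈ S, 0 < kweight N m A B x X := fun X hX => kweight_pos hm hmN hA hB hx0 hX
  set c := x ^ 2 with hc
  set dS := ∑ X ∈ S, kweight N m A B x X * |p.2 X - q.2 X|
  have hmem : {m, m + 1} ∈ S := mem_filter.2 ⟨pair_mem_sector hm hmN, by simp⟩
  have hle : kweight N m A B x {m, m + 1} * |p.2 {m, m + 1} - q.2 {m, m + 1}| ≤ dS :=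
    single_le_sum (f := fun X => kweight N m A B x X * |p.2 X - q.2 X|)
      (fun X hX => mul_nonneg (hgpos X hX).le (abs_nonneg _)) hmem
  have hw : 2 * x⁻¹ ≤ kweight N m A B x {m, m + 1} := by
    rw [mem_filter] at hmem
    refine mul_le_mul (lam_bounds hm hmN hA hB hmem.1 hmem.2).2 ?_ (by positivity)
      (by linarith [(lam_bounds hm hmN hA hB hmem.1 hmem.2).2])
    refine inv_anti₀ (pow_pos hx0 _) ?_
    simpa using pow_le_pow_of_le_one hx0.le hx1 (one_le_toNat_kw hmN hmem.1 hmem.2)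
  have heq : (kinkF N m ε A B p - kinkF N m ε A B q).1 =
      2 * ε * (p.2 {m, m + 1} - q.2 {m, m + 1}) := by
    simp only [kinkF, Prod.fst_sub]
    ring
  rw [heq, abs_mul, abs_mul, abs_two]
  calc c⁻¹ * (2 * |ε| * |p.2 {m, m + 1} - q.2 {m, m + 1}|)
      = 1 / K * (2 * x⁻¹ * |p.2 {m, m + 1} - q.2 {m, m + 1}|) := by
        rw [hc, hx]
        field_simp
    _ ≤ 1 / K * dS := by
        refine mul_le_mul_of_nonneg_left (le_trans ?_ hle) (by positivity)
        exact mul_le_mul_of_nonneg_right hw (abs_nonneg _)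

lemma kinkF_sub_snd_le {N m : ℕ} {A B x : ℝ} (ε : ℝ) (hm : 0 < m) (hmN : m < N)
    (hA : 1 ≤ A) (hB : 1 ≤ B) (hx0 : 0 < x) (p q : ℝ × (Finset ℕ → ℝ))
    {X : Finset ℕ} (hX : X ∈ (sector N m).filter (· ≠ ∅)) :
    kweight N m A B x X * |(kinkF N m ε A B p - kinkF N m ε A B q).2 X| ≤
      2 * |ε| * ((x ^ (kw N m X).toNat)⁻¹ * ∑ j ∈ bdry N (X ∆ Icc 1 m),
        |kext p.2 (X ∆ {j, j + 1}) - kext q.2 (X ∆ {j, j + 1})|) +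
      (|p.1 - q.1| / 2 * (kweight N m A B x X * |p.2 X|) +
        |q.1| / 2 * (kweight N m A B x X * |p.2 X - q.2 X|)) := by
  have hg := kweight_pos hm hmN hA hB hx0 hX
  have hiv : 0 < (x ^ (kw N m X).toNat)⁻¹ := inv_pos.2 (pow_pos hx0 _)
  rw [← abs_of_pos hg, ← abs_mul, Prod.snd_sub, Pi.sub_apply, mul_sub,
    kweight_mul_kinkF_snd ε hm hmN hA hB hX, kweight_mul_kinkF_snd ε hm hmN hA hB hX,
    ← mul_sub, abs_mul, abs_of_pos hiv, abs_of_pos hg]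
  have hgw : 2 * (x ^ (kw N m X).toNat)⁻¹ ≤ kweight N m A B x X :=
    mul_le_mul_of_nonneg_right
      (lam_bounds hm hmN hA hB (mem_filter.1 hX).1 (mem_filter.1 hX).2).2 hiv.le
  set hop := ∑ j ∈ bdry N (X ∆ Icc 1 m),
      |kext p.2 (X ∆ {j, j + 1}) - kext q.2 (X ∆ {j, j + 1})|
  have hin : |-2 * ε * ∑ j ∈ bdry N (X ∆ Icc 1 m), kext p.2 (X ∆ {j, j + 1}) + p.1 * p.2 X -
      (-2 * ε * ∑ j ∈ bdry N (X ∆ Icc 1 m), kext q.2 (X ∆ {j, j + 1}) + q.1 * q.2 X)| ≤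
      2 * |ε| * hop + (|p.1 - q.1| * |p.2 X| + |q.1| * |p.2 X - q.2 X|) := by
    have : -2 * ε * ∑ j ∈ bdry N (X ∆ Icc 1 m), kext p.2 (X ∆ {j, j + 1}) + p.1 * p.2 X -
      (-2 * ε * ∑ j ∈ bdry N (X ∆ Icc 1 m), kext q.2 (X ∆ {j, j + 1}) + q.1 * q.2 X) =
      -2 * ε * ∑ j ∈ bdry N (X ∆ Icc 1 m),
        (kext p.2 (X ∆ {j, j + 1}) - kext q.2 (X ∆ {j, j + 1})) +
      ((p.1 - q.1) * p.2 X + q.1 * (p.2 X - q.2 X)) := by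
      rw [sum_sub_distrib]
      ring
    rw [this]
    refine (abs_add_le _ _).trans (add_le_add ?_ ((abs_add_le _ _).trans_eq ?_))
    · rw [abs_mul, abs_mul, abs_neg, abs_two]
      exact mul_le_mul_of_nonneg_left (abs_sum_le_sum_abs _ _) (by positivity)
    · rw [abs_mul, abs_mul]
  refine (mul_le_mul_of_nonneg_left hin hiv.le).trans ?_
  have h1 := mul_le_mul_of_nonneg_right hgw
    (by positivity : 0 ≤ |p.1 - q.1| * |p.2 X| + |q.1| * |p.2 X - q.2 X|)
  linarith

lemma kwnormReal_kinkF_sub_le {N m : ℕ} {A B K ε δ : ℝ} (hm : 0 < m) (hmN : m < N)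
    (hA : 1 ≤ A) (hB : 1 ≤ B) (hx0 : 0 < K * |ε|) (hx1 : K * |ε| ≤ 1)
    {p q : ℝ × (Finset ℕ → ℝ)} (hp : kwnormReal N m A B (K * |ε|) p ≤ δ)
    (hq : kwnormReal N m A B (K * |ε|) q ≤ δ) :
    kwnormReal N m A B (K * |ε|) (kinkF N m ε A B p - kinkF N m ε A B q) ≤
      (3 / K + δ) * kwnormReal N m A B (K * |ε|) (p - q) := by
  have hε : 0 < |ε| := (abs_nonneg ε).lt_of_ne fun h => by simp [← h] at hx0
  have hK : 0 < K := pos_of_mul_pos_left hx0 hε.le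
  set x := K * |ε| with hx
  set S := (sector N m).filter (· ≠ ∅)
  have hgpos : ∀ X ∈ S, 0 < kweight N m A B x X := fun X hX => kweight_pos hm hmN hA hB hx0 hX
  set c := x ^ 2
  have hc0 : 0 < c := by positivity
  have hc1 : c ≤ 1 := pow_le_one₀ hx0.le hx1
  set d := kwnormReal N m A B x (p - q)
  set dS := ∑ X ∈ S, kweight N m A B x X * |p.2 X - q.2 X| with hdS
  have hd' : d = c⁻¹ * |p.1 - q.1| + dS := rfl
  have hdS0 : 0 ≤ dS := sum_nonneg fun X hX => mul_nonneg (hgpos X hX).le (abs_nonneg _)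
  set pS := ∑ X ∈ S, kweight N m A B x X * |p.2 X|
  have hpS0 : 0 ≤ pS := sum_nonneg fun X hX => mul_nonneg (hgpos X hX).le (abs_nonneg _)
  have hp' : c⁻¹ * |p.1| + pS ≤ δ := hp
  have hq' : c⁻¹ * |q.1| ≤ δ :=
    (le_add_of_nonneg_right
      (sum_nonneg fun X hX => mul_nonneg (hgpos X hX).le (abs_nonneg _))).trans hq
  have hinv1 : 1 ≤ c⁻¹ := (one_le_inv₀ hc0).2 hc1
  have hfst : c⁻¹ * |(kinkF N m ε A B p - kinkF N m ε A B q).1| ≤ 1 / K * dS :=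
    kinkF_sub_fst_le hm hmN hA hB hx0 hx1 p q
  have hhop := sum_hopping_filter_le (A := A) (B := B) hm hmN hA hB hx0 hx1
    (h := fun X => |kext p.2 X - kext q.2 X|) fun X => abs_nonneg _
  have hhop' : |kext p.2 ∅ - kext q.2 ∅| + ∑ X ∈ S, (lam N m A B X - 2) *
      (x ^ (kw N m X).toNat)⁻¹ * |kext p.2 X - kext q.2 X| = dS := by
    rw [hdS]
    simp only [kext, if_pos, sub_self, abs_zero, zero_add]
    refine sum_congr rfl fun X hX => ?_
    rw [if_neg (mem_filter.1 hX).2, if_neg (mem_filter.1 hX).2]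
    rfl
  have hsnd : ∑ X ∈ S, kweight N m A B x X * |(kinkF N m ε A B p - kinkF N m ε A B q).2 X| ≤
      2 / K * dS + (|p.1 - q.1| / 2 * pS + |q.1| / 2 * dS) := by
    refine (sum_le_sum fun X hX => kinkF_sub_snd_le ε hm hmN hA hB hx0 p q hX).trans ?_
    rw [sum_add_distrib, sum_add_distrib, ← mul_sum, ← mul_sum, ← mul_sum]
    refine add_le_add_left ?_ _
    refine (mul_le_mul_of_nonneg_left hhop (by positivity)).trans_eq ?_
    rw [hhop', hx]
    field_simp
  have hp1 : pS ≤ δ := (le_add_of_nonneg_left (by positivity)).trans hp'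
  have hq1 : |q.1| ≤ δ := (le_mul_of_one_le_left (abs_nonneg _) hinv1).trans hq'
  have hδ : 0 ≤ δ := hpS0.trans hp1
  have hE : |p.1 - q.1| ≤ c⁻¹ * |p.1 - q.1| := le_mul_of_one_le_left (abs_nonneg _) hinv1
  have h1 : |p.1 - q.1| / 2 * pS ≤ c⁻¹ * |p.1 - q.1| / 2 * δ :=
    mul_le_mul (by linarith) hp1 hpS0 (by positivity)
  have h2 : |q.1| / 2 * dS ≤ δ / 2 * dS := mul_le_mul_of_nonneg_right (by linarith) hdS0
  have h3 : 0 ≤ c⁻¹ * |p.1 - q.1| := by positivity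
  calc _ ≤ 1 / K * dS + (2 / K * dS + (|p.1 - q.1| / 2 * pS + |q.1| / 2 * dS)) :=
        add_le_add hfst hsnd
    _ ≤ (3 / K + δ) * d := by
        rw [hd']
        have h4 : 0 ≤ 3 / K * (c⁻¹ * |p.1 - q.1|) := by positivity
        have h5 : 1 / K * dS + 2 / K * dS = 3 / K * dS := by ring
        have h6 := mul_nonneg hδ h3
        have h7 := mul_nonneg hδ hdS0
        rw [add_mul, mul_add, mul_add]
        linarith

lemma existsUnique_kink_fixedPoint {N m : ℕ} {A B ε : ℝ} (hm : 0 < m) (hmN : m < N)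
    (hA : 1 ≤ A) (hB : 1 ≤ B) (hx0 : 0 < 16 * |ε|) (hx1 : 16 * |ε| < 1) :
    ∃! p : ℝ × (Finset ℕ → ℝ),
      kwnormReal N m A B (16 * |ε|) p ≤ 1 / 2 ∧ kinkF N m ε A B p = p := by
  have hg : ∀ X ∈ (sector N m).filter (· ≠ ∅), 0 < kweight N m A B (16 * |ε|) X :=
    fun X hX => kweight_pos hm hmN hA hB hx0 hX
  have ha : 0 < ((16 * |ε|) ^ 2)⁻¹ := by positivity
  refine existsUnique_fixedPoint_weightedL1 (k := 11 / 16) ha hg (kinkF N m ε A B) ?_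
    (by norm_num) (by norm_num) (by norm_num) ?_ ?_
  · intro p X hX
    rw [mem_filter] at hX
    exact if_neg hX
  · intro p hp
    have h0 : kwnormReal N m A B (16 * |ε|) 0 ≤ 1 / 2 := by simp [kwnormReal, weightedL1]
    have h1 := kwnormReal_kinkF_sub_le hm hmN hA hB hx0 hx1.le hp h0
    have h2 := kwnormReal_kinkF_zero_le hm hmN hA hB hx0 hx1.le
    have h3 := weightedL1_add_le ha.le (fun X hX => (hg X hX).le)
      (kinkF N m ε A B p - kinkF N m ε A B 0) (kinkF N m ε A B 0)
    rw [sub_add_cancel] at h3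
    rw [sub_zero] at h1
    change kwnormReal N m A B (16 * |ε|) p ≤ _ at hp
    change kwnormReal _ _ _ _ _ _ ≤ kwnormReal _ _ _ _ _ _ + kwnormReal _ _ _ _ _ _ at h3
    change kwnormReal _ _ _ _ _ _ ≤ _
    linarith
  · intro p q hp hq
    exact (kwnormReal_kinkF_sub_le hm hmN hA hB hx0 hx1.le hp hq).trans_eq (by
      norm_num
      rfl)

lemma kinkF_zero_coupling_fixedPoint_iff (N m : ℕ) (A B : ℝ) (p : ℝ × (Finset ℕ → ℝ)) :
    kinkF N m 0 A B p = p ↔ p = 0 := by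
  constructor
  · intro h
    have h1 : p.1 = 0 := by
      rw [← h]
      simp [kinkF]
    refine Prod.ext h1 (funext fun X => ?_)
    rw [← h]
    simp [kinkF, h1]
  · rintro rfl
    refine Prod.ext ?_ (funext fun X => ?_) <;> simp [kinkF]

theorem kink_fixed_point_weighted :
    ∃ K δ : ℝ, 0 < K ∧ 0 < δ ∧
      ∀ (N m : ℕ) (ε A B : ℝ), 0 < m → m < N → 1 ≤ A → 1 ≤ B → K * |ε| < 1 →
        (∃! p : ℝ × (Finset ℕ → ℝ),
            kwnorm N m A B K ε p ≤ ENNReal.ofReal δ ∧ kinkF N m ε A B p = p) ∧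
        ∀ p : ℝ × (Finset ℕ → ℝ),
          kwnorm N m A B K ε p ≤ ENNReal.ofReal δ → kinkF N m ε A B p = p →
            |p.1| ≤ δ * (K * |ε|) ^ 2 ∧
            ∀ X ∈ (sector N m).filter (· ≠ ∅),
              ENNReal.ofReal ((lam N m A B X - 2) * |p.2 X|)
                ≤ ENNReal.ofReal δ * epow (ENNReal.ofReal (K * |ε|)) (kw N m X) := by
  refine ⟨16, 1 / 2, by norm_num, by norm_num, fun N m ε A B hm hmN hA hB hx1 => ⟨?_, ?_⟩⟩
  · rcases eq_or_ne ε 0 with rfl | hε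
    · refine ⟨0, ⟨by simp [kwnorm], (kinkF_zero_coupling_fixedPoint_iff N m A B 0).2 rfl⟩, ?_⟩
      rintro p ⟨-, hp⟩
      exact (kinkF_zero_coupling_fixedPoint_iff N m A B p).1 hp
    · have hx0 : 0 < 16 * |ε| := by positivity
      simp_rw [kwnorm_eq_ofReal hm hmN hA hB hx0,
        ENNReal.ofReal_le_ofReal_iff (by norm_num : (0 : ℝ) ≤ 1 / 2)]
      exact existsUnique_kink_fixedPoint hm hmN hA hB hx0 hx1
  · intro p hp _
    have hδ0 : ENNReal.ofReal (1 / 2) ≠ 0 := by simp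
    have hmul {a b : ℝ≥0∞} (h : a / b ≤ ENNReal.ofReal (1 / 2)) :
        a ≤ ENNReal.ofReal (1 / 2) * b :=
      (ENNReal.div_le_iff_le_mul (Or.inr ENNReal.ofReal_ne_top) (Or.inr hδ0)).1 h
    refine ⟨?_, fun X hX => hmul ?_⟩
    · have h := hmul (le_self_add.trans hp)
      rwa [← ENNReal.ofReal_pow (by positivity), ← ENNReal.ofReal_mul (by norm_num),
        ENNReal.ofReal_le_ofReal_iff (by positivity)] at h
    · refine le_trans ?_ (le_add_self.trans hp)
      exact single_le_sum (f := fun X => ENNReal.ofReal ((lam N m A B X - 2) * |p.2 X|)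
        / epow (ENNReal.ofReal (16 * |ε|)) (kw N m X)) (fun _ _ => zero_le) hX
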